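/- arXiv:2602.10391 — 2 statements merged into one kernel-verified Lean document; each statement's English description precedes it below -/
import Mathlib

section
/- Let x be a root of unity and let a, b ∈ ℂ∖ℤ with b − a ∉ {−1,−2,−3,…}. Then Li_{2,2}(x^{−1}, −x; 1−b, 1−a) − Li_{2,2}(−x^{−1}, x; a, b) + x^{−1} Li_2(x; b) Li_2(−x; 1−a) = π² csc(πa) cot(πa) Li_2(x; 1+b−a) + π² csc(πb) cot(πb) Li_2(−x; 1+b−a) + 2π csc(πb) Li_3(−x; 1+b−a) − 2π csc(πa) Li_3(x; 1+b−a), where csc(w) = 1/sin(w) and cot(w) = cos(w)/sin(w). -/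
open Filter Finset

/-- A complex number is a root of unity if some positive power of it equals 1. -/
def IsRootOfUnity (z : ℂ) : Prop := ∃ N : ℕ, 0 < N ∧ z ^ N = 1

open scoped Classical in
/-- Partial sum `Σ_{0<n_1<⋯<n_r≤N} Π_j x_j^{n_j} (n_j + b_j − 1)^{−k_j}` where the list `K`
consists of the triples `(k_j, x_j, b_j)`. -/
noncomputable def cmhzP (K : List (ℕ × ℂ × ℂ)) (N : ℕ) : ℂ :=
  ∑ n ∈ Finset.univ.filter (fun n : Fin K.length → Fin N => StrictMono n),
    ∏ j : Fin K.length,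
      (K.get j).2.1 ^ ((n j : ℕ) + 1) /
        ((((n j : ℕ) + 1 : ℕ) : ℂ) + (K.get j).2.2 - 1) ^ (K.get j).1

/-- Cyclotomic multiple Hurwitz zeta value: the limit of the partial sums `cmhzP`. -/
noncomputable def cmhz (K : List (ℕ × ℂ × ℂ)) : ℂ := limUnder atTop (cmhzP K)

/-- Cyclotomic multiple zeta value (all Hurwitz parameters equal to 1). -/
noncomputable def cmzv (K : List (ℕ × ℂ)) : ℂ := cmhz (K.map fun p => (p.1, p.2, 1))

/-- Cyclotomic multiple t-value (all Hurwitz parameters equal to 1/2). -/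
noncomputable def tval (K : List (ℕ × ℂ)) : ℂ := cmhz (K.map fun p => (p.1, p.2, (1 : ℂ)/2))

/-- Depth-one cyclotomic zeta value `Li_k(x)`. -/
noncomputable def li1 (k : ℕ) (x : ℂ) : ℂ := cmzv [(k, x)]

/-- Depth-one cyclotomic Hurwitz zeta value `Li_k(x; b)`. -/
noncomputable def lih1 (k : ℕ) (x b : ℂ) : ℂ := cmhz [(k, x, b)]

/-- Depth-one cyclotomic t-value `t_k(x)`. -/
noncomputable def tval1 (k : ℕ) (x : ℂ) : ℂ := tval [(k, x)]

/-- The generalized digamma-type series `φ(s; x) = Σ_{k≥0} x^k/(k+s)`. -/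
noncomputable def phiF (s x : ℂ) : ℂ :=
  limUnder atTop (fun N : ℕ => ∑ t ∈ Finset.range (N + 1), x ^ t / ((t : ℂ) + s))

/-- The extended trigonometric function `Φ(s; x) = φ(s; x) − φ(−s; x⁻¹) − 1/s`. -/
noncomputable def PhiF (s x : ℂ) : ℂ := phiF s x - phiF (-s) x⁻¹ - 1 / s


lemma aux_hasSum_congr {ι : Type*} {f g : ι → ℂ} {u v : ℂ} (h : HasSum f u)
    (hf : ∀ i, g i = f i) (huv : v = u) : HasSum g v := by
  rw [huv, funext hf]
  exact h

lemma aux_ne {z : ℂ} (hz : ∀ k : ℤ, z ≠ k) (m : ℤ) : (m : ℂ) + z ≠ 0 := by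
  intro h
  apply hz (-m)
  push_cast
  linear_combination h

lemma aux_summable_sq (z : ℂ) : Summable fun m : ℤ => 1 / ‖(m : ℂ) + z‖ ^ 2 := by
  have h := (EisensteinSeries.linear_right_summable z 1 (k := 2) le_rfl).norm
  refine h.congr fun m => ?_
  simp [add_comm]

lemma aux_inv_mul_le {x y : ℝ} (hx : 0 ≤ x) (hy : 0 ≤ y) :
    1 / (x * y) ≤ 1 / x ^ 2 + 1 / y ^ 2 := by
  have := two_mul_le_add_sq x⁻¹ y⁻¹
  have h1 : 0 ≤ x⁻¹ * y⁻¹ := by positivity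
  simp only [one_div, mul_inv, ← inv_pow]
  nlinarith

lemma aux_summable_diff {z w : ℂ} (hz : ∀ k : ℤ, z ≠ k) (hw : ∀ k : ℤ, w ≠ k) :
    Summable fun m : ℤ => 1 / ((m : ℂ) + z) - 1 / ((m : ℂ) + w) := by
  refine Summable.of_norm_bounded
    (((aux_summable_sq z).add (aux_summable_sq w)).mul_left ‖w - z‖) fun m => ?_
  have h1 := aux_ne hz m
  have h2 := aux_ne hw m
  have : 1 / ((m : ℂ) + z) - 1 / ((m : ℂ) + w) = (w - z) * (1 / ((m + z) * (m + w))) := by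
    field_simp
    ring
  rw [this, norm_mul, norm_div, norm_mul, norm_one]
  exact mul_le_mul_of_nonneg_left (aux_inv_mul_le (norm_nonneg _) (norm_nonneg _)) (norm_nonneg _)

lemma aux_cot_series {z : ℂ} (hz : ∀ k : ℤ, z ≠ k) :
    HasSum (fun n : ℕ => 1 / (z - (n + 1)) + 1 / (z + (n + 1)))
      ((Real.pi : ℂ) * Complex.cot (Real.pi * z) - 1 / z) := by
  have h : z ∈ Complex.integerComplement := by
    rw [Complex.mem_integerComplement_iff]
    rintro ⟨n, hn⟩
    exact hz n hn.symm
  rw [cot_series_rep' h]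
  exact (summable_cotTerm h).hasSum

lemma aux_cot_diff {z w : ℂ} (hz : ∀ k : ℤ, z ≠ k) (hw : ∀ k : ℤ, w ≠ k) :
    HasSum (fun m : ℤ => 1 / ((m : ℂ) + z) - 1 / ((m : ℂ) + w))
      ((Real.pi : ℂ) * Complex.cot (Real.pi * z) - Real.pi * Complex.cot (Real.pi * w)) := by
  have hs := (aux_summable_diff hz hw).hasSum
  have h1 := hs.nat_add_neg
  rw [← hasSum_nat_add_iff' 1] at h1
  have h2 := (aux_cot_series hz).sub (aux_cot_series hw)
  have h3 := h1.unique (h2.congr_fun ?_)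
  · refine aux_hasSum_congr hs (fun _ => rfl) ?_
    simp only [range_one, sum_singleton, Nat.cast_zero, Int.cast_zero, neg_zero, zero_add,
      Int.cast_neg, Int.cast_natCast] at h3
    linear_combination -h3
  · intro n
    push_cast
    have e1 : (-(n+1:ℂ) + z) = z - (n+1) := by ring
    have e2 : (-(n+1:ℂ) + w) = w - (n+1) := by ring
    have e3 : ((n+1:ℂ) + z) = z + (n+1) := by ring
    have e4 : ((n+1:ℂ) + w) = w + (n+1) := by ring
    rw [e1, e2, e3, e4]
    ring

lemma aux_csc {z : ℂ} (hz : ∀ k : ℤ, z ≠ k) :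
    Complex.cot (Real.pi * (z / 2)) - Complex.cot (Real.pi * z)
      = (Complex.sin (Real.pi * z))⁻¹ := by
  have hs : Complex.sin (Real.pi * z) ≠ 0 := by
    apply sin_pi_mul_ne_zero
    rw [Complex.mem_integerComplement_iff]
    rintro ⟨n, hn⟩
    exact hz n hn.symm
  have e : (Real.pi : ℂ) * z = 2 * (Real.pi * (z / 2)) := by ring
  rw [e] at hs ⊢
  generalize (Real.pi * (z / 2) : ℂ) = y at *
  rw [Complex.sin_two_mul] at *
  have h1 : Complex.sin y ≠ 0 := fun h => hs (by simp [h])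
  have h2 : Complex.cos y ≠ 0 := fun h => hs (by simp [h])
  rw [Complex.cot_eq_cos_div_sin, Complex.cot_eq_cos_div_sin, Complex.sin_two_mul,
    Complex.cos_two_mul]
  field_simp
  ring

lemma aux_csc_diff {z w : ℂ} (hz : ∀ k : ℤ, z ≠ k) (hw : ∀ k : ℤ, w ≠ k) :
    HasSum (fun m : ℤ => (-1 : ℂ) ^ m * (1 / ((m : ℂ) + z) - 1 / ((m : ℂ) + w)))
      ((Real.pi : ℂ) * (Complex.sin (Real.pi * z))⁻¹
        - Real.pi * (Complex.sin (Real.pi * w))⁻¹) := by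
  have half : ∀ {z : ℂ}, (∀ k : ℤ, z ≠ k) → ∀ k : ℤ, z / 2 ≠ k := by
    intro z hz k h
    apply hz (2 * k)
    push_cast
    linear_combination 2 * h
  have hall := aux_cot_diff hz hw
  have hev := aux_cot_diff (half hz) (half hw)
  have hinj : Function.Injective (fun m : ℤ => 2 * m) := fun a b h => by
    simpa using h
  have hev' : HasSum (fun m : ℤ => if Even m then
      2 * (1 / ((m : ℂ) + z) - 1 / ((m : ℂ) + w)) else 0)
      ((Real.pi : ℂ) * Complex.cot (Real.pi * (z / 2))
        - Real.pi * Complex.cot (Real.pi * (w / 2))) := by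
    refine (hinj.hasSum_iff ?_).1 (hev.congr_fun ?_)
    · intro m hm
      rw [if_neg]
      rintro ⟨r, hr⟩
      exact hm ⟨r, by simp; omega⟩
    · intro m
      simp only [Function.comp]
      rw [if_pos (even_two_mul m)]
      have h1 := aux_ne (half hz) m
      have h2 := aux_ne (half hw) m
      have e1 : (((2 * m : ℤ) : ℂ) + z) = 2 * (m + z / 2) := by push_cast; ring
      have e2 : (((2 * m : ℤ) : ℂ) + w) = 2 * (m + w / 2) := by push_cast; ring
      rw [e1, e2]
      field_simp
  have := hev'.sub hall
  rw [← aux_csc hz, ← aux_csc hw]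
  refine aux_hasSum_congr this ?_ ?_
  · intro m
    split_ifs with h
    · rw [h.neg_one_zpow]; ring
    · rw [(Int.not_even_iff_odd.1 h).neg_one_zpow]; ring
  · ring

lemma aux_csc_sq {z : ℂ} (hz : ∀ k : ℤ, z ≠ k) :
    HasSum (fun m : ℤ => (-1 : ℂ) ^ m / ((m : ℂ) + z) ^ 2)
      ((Real.pi : ℂ) ^ 2 * (Complex.sin (Real.pi * z))⁻¹
        * (Complex.cos (Real.pi * z) / Complex.sin (Real.pi * z))) := by
  have hmem : z ∈ (Set.range ((↑) : ℤ → ℂ))ᶜ := by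
    rintro ⟨n, hn⟩
    exact hz n hn.symm
  obtain ⟨ε, hε, hball⟩ := Metric.isOpen_iff.1 Complex.isOpen_compl_range_intCast z hmem
  have hd : ∀ m : ℤ, ε ≤ ‖(m : ℂ) + z‖ := by
    intro m
    by_contra hlt
    have : ((-m : ℤ) : ℂ) ∈ Metric.ball z ε := by
      rw [Metric.mem_ball, dist_eq_norm, ← norm_neg]
      push_cast
      have e : -(-(m : ℂ) - z) = m + z := by ring
      rw [e]
      exact not_le.1 hlt
    exact hball this ⟨_, rfl⟩
  have hsin : Complex.sin (Real.pi * z) ≠ 0 := by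
    apply sin_pi_mul_ne_zero
    rw [Complex.mem_integerComplement_iff]
    rintro ⟨n, hn⟩
    exact hz n hn.symm
  have hnorm : ∀ m : ℤ, ‖(-1 : ℂ) ^ m‖ = 1 := fun m => by simp [norm_zpow]
  have hsum : Summable (fun m : ℤ => (-1 : ℂ) ^ m / ((m : ℂ) + z) ^ 2) := by
    refine Summable.of_norm_bounded (aux_summable_sq z) fun m => ?_
    rw [norm_div, hnorm, norm_pow]
  have hev : ∀ᶠ w in nhdsWithin z {z}ᶜ, w ∈ Metric.ball z (ε / 2) :=
    mem_nhdsWithin_of_mem_nhds (Metric.ball_mem_nhds z (by positivity))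
  have hne : ∀ w ∈ Metric.ball z (ε / 2), ∀ k : ℤ, w ≠ k := by
    intro w hw k hk
    exact hball (Metric.ball_subset_ball (by linarith) hw) ⟨k, hk.symm⟩
  have T1 : Tendsto (fun w => ∑' m : ℤ, (-1 : ℂ) ^ m / (((m : ℂ) + z) * (m + w)))
      (nhdsWithin z {z}ᶜ) (nhds (∑' m : ℤ, (-1 : ℂ) ^ m / ((m : ℂ) + z) ^ 2)) := by
    refine tendsto_tsum_of_dominated_convergence ((aux_summable_sq z).mul_left 2) ?_ ?_
    · intro m
      have h1 := aux_ne hz m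
      have : ContinuousAt (fun w : ℂ => (-1 : ℂ) ^ m / (((m : ℂ) + z) * (m + w))) z := by
        apply ContinuousAt.div
        · fun_prop
        · fun_prop
        · exact mul_ne_zero h1 h1
      have := this.tendsto.mono_left (nhdsWithin_le_nhds (s := {z}ᶜ))
      simpa [sq] using this
    · filter_upwards [hev] with w hw m
      have h1 := hd m
      have h2 : ‖(m : ℂ) + z‖ / 2 ≤ ‖(m : ℂ) + w‖ := by
        rw [Metric.mem_ball, dist_comm, dist_eq_norm] at hw
        have : (m : ℂ) + z = (m + w) + (z - w) := by ring
        have h3 := norm_add_le ((m : ℂ) + w) (z - w)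
        rw [← this] at h3
        linarith
      have h0 : 0 < ‖(m : ℂ) + z‖ := by linarith
      rw [norm_div, hnorm, norm_mul]
      calc 1 / (‖(m : ℂ) + z‖ * ‖(m : ℂ) + w‖) ≤ 1 / (‖(m : ℂ) + z‖ * (‖(m : ℂ) + z‖ / 2)) := by
            gcongr
        _ = 2 * (1 / ‖(m : ℂ) + z‖ ^ 2) := by field_simp
  have hD : HasDerivAt (fun w : ℂ => (Real.pi : ℂ) * (Complex.sin (Real.pi * w))⁻¹)
      (-((Real.pi : ℂ) ^ 2 * (Complex.sin (Real.pi * z))⁻¹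
        * (Complex.cos (Real.pi * z) / Complex.sin (Real.pi * z)))) z := by
    have h1 : HasDerivAt (fun w : ℂ => (Real.pi : ℂ) * w) (Real.pi : ℂ) z := by
      simpa using (hasDerivAt_id z).const_mul (Real.pi : ℂ)
    refine ((h1.csin.fun_inv hsin).const_mul (Real.pi : ℂ)).congr_deriv ?_
    simp only [div_eq_mul_inv, ← inv_pow]
    ring
  have T2 := (hasDerivAt_iff_tendsto_slope.1 hD).neg
  rw [neg_neg] at T2
  have hEq : ∀ᶠ w in nhdsWithin z {z}ᶜ,
      -(slope (fun w : ℂ => (Real.pi : ℂ) * (Complex.sin (Real.pi * w))⁻¹) z w)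
        = ∑' m : ℤ, (-1 : ℂ) ^ m / (((m : ℂ) + z) * (m + w)) := by
    filter_upwards [hev, self_mem_nhdsWithin] with w hw hwz
    have hwz' : w - z ≠ 0 := sub_ne_zero.2 hwz
    have h := (aux_csc_diff hz (hne w hw)).mul_left (w - z)⁻¹
    have e : ∀ m : ℤ, (-1 : ℂ) ^ m / (((m : ℂ) + z) * (m + w))
        = (w - z)⁻¹ * ((-1 : ℂ) ^ m * (1 / ((m : ℂ) + z) - 1 / ((m : ℂ) + w))) := by
      intro m
      have h1 := aux_ne hz m
      have h2 := aux_ne (hne w hw) m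
      field_simp
      ring
    rw [tsum_congr e, h.tsum_eq, slope_def_field]
    field_simp
    ring
  have := tendsto_nhds_unique T1 (T2.congr' hEq)
  rw [← this]
  exact hsum.hasSum

lemma aux_sin_shift (b : ℂ) (t : ℕ) :
    Complex.sin (Real.pi * (b + t)) = (-1) ^ t * Complex.sin (Real.pi * b) := by
  rw [mul_add, mul_comm (Real.pi : ℂ) (t : ℂ)]
  exact Complex.sin_antiperiodic.add_nat_mul_eq t

lemma aux_cos_shift (b : ℂ) (t : ℕ) :
    Complex.cos (Real.pi * (b + t)) = (-1) ^ t * Complex.cos (Real.pi * b) := by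
  rw [mul_add, mul_comm (Real.pi : ℂ) (t : ℂ)]
  exact Complex.cos_antiperiodic.add_nat_mul_eq t

/-- The inner sum over the integers. -/
lemma aux_inner {a b : ℂ} (ha : ∀ k : ℤ, a ≠ k) (hb : ∀ k : ℤ, b ≠ k) (t : ℕ)
    (hs : (t : ℂ) + b - a ≠ 0) :
    HasSum (fun m : ℤ => (-1 : ℂ) ^ m / (((t : ℂ) - m + b) ^ 2 * ((m : ℂ) - a) ^ 2))
      (((Real.pi : ℂ) ^ 2 * (Complex.sin (Real.pi * a))⁻¹
        * (Complex.cos (Real.pi * a) / Complex.sin (Real.pi * a)) +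
      (-1) ^ t * ((Real.pi : ℂ) ^ 2 * (Complex.sin (Real.pi * b))⁻¹
        * (Complex.cos (Real.pi * b) / Complex.sin (Real.pi * b)))) / ((t : ℂ) + b - a) ^ 2
      + 2 * ((-1) ^ t * (Real.pi * (Complex.sin (Real.pi * b))⁻¹)
        - Real.pi * (Complex.sin (Real.pi * a))⁻¹) / ((t : ℂ) + b - a) ^ 3) := by
  have ha' : ∀ k : ℤ, -a ≠ k := fun k h => ha (-k) (by push_cast; linear_combination -h)
  have hb' : ∀ k : ℤ, -(b + t) ≠ k := fun k h =>
    hb (-k - t) (by push_cast; linear_combination -h)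
  have h1 := aux_csc_sq ha'
  have h2 := aux_csc_sq hb'
  have h3 := aux_csc_diff ha' hb'
  have h := ((h1.add h2).mul_left (1 / ((t : ℂ) + b - a) ^ 2)).add
    (h3.mul_left (2 / ((t : ℂ) + b - a) ^ 3))
  refine aux_hasSum_congr h ?_ ?_
  · intro m
    have e1 := aux_ne ha' m
    have e2 := aux_ne hb' m
    have e3 : (t : ℂ) - m + b = -(m + -(b + t)) := by ring
    have e4 : (t : ℂ) + b - a = (m + -a) - (m + -(b + t)) := by ring
    rw [e4] at hs ⊢
    rw [e3, sub_eq_add_neg (m : ℂ) a]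
    generalize (m : ℂ) + -a = u at *
    generalize (m : ℂ) + -(b + t) = v at *
    field_simp
    ring
  · simp only [mul_neg, Complex.sin_neg, Complex.cos_neg, aux_sin_shift, aux_cos_shift]
    have hp : ((-1 : ℂ) ^ t)⁻¹ = (-1) ^ t := by
      rw [← inv_pow]; norm_num
    have hq : ((-1 : ℂ) ^ t) * (-1) ^ t = 1 := by
      rw [← mul_pow]; norm_num
    simp only [div_eq_mul_inv, inv_neg, mul_inv, hp]
    generalize (-1 : ℂ) ^ t = e at *
    linear_combination (-(Real.pi : ℂ) ^ 2 * e * (Complex.sin (Real.pi * b))⁻¹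
        * (Complex.cos (Real.pi * b) * (Complex.sin (Real.pi * b))⁻¹) *
          (((t : ℂ) + b - a) ^ 2)⁻¹) * hq

lemma aux_cmhzP_one (k : ℕ) (x b : ℂ) (N : ℕ) :
    cmhzP [(k, x, b)] N
      = ∑ n ∈ range N, x ^ (n + 1) / (((n + 1 : ℕ) : ℂ) + b - 1) ^ k := by
  unfold cmhzP
  rw [Finset.sum_range, Finset.sum_filter]
  refine Fintype.sum_equiv (Equiv.funUnique (Fin 1) (Fin N)) _ _ fun n => ?_
  rw [if_pos (Subsingleton.strictMono (α := Fin 1) n)]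
  exact Fin.prod_univ_one _

lemma aux_cmhzP_two (k l : ℕ) (x b y c : ℂ) (N : ℕ) :
    cmhzP [(k, x, b), (l, y, c)] N
      = ∑ p ∈ range N ×ˢ range N, if p.1 < p.2 then
          x ^ (p.1 + 1) / (((p.1 + 1 : ℕ) : ℂ) + b - 1) ^ k *
          (y ^ (p.2 + 1) / (((p.2 + 1 : ℕ) : ℂ) + c - 1) ^ l) else 0 := by
  unfold cmhzP
  rw [Finset.sum_product, Finset.sum_range]
  simp_rw [Finset.sum_range]
  rw [← Fintype.sum_prod_type', Finset.sum_filter]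
  refine Fintype.sum_equiv (finTwoArrowEquiv (Fin N)) _ _ fun n => ?_
  have h : StrictMono (show Fin 2 → Fin N from n) ↔ (n 0 : ℕ) < (n 1 : ℕ) := by
    rw [Fin.strictMono_iff_lt_succ]
    simp
  have h2 := Fin.prod_univ_two (fun j : Fin 2 =>
      (([(k, x, b), (l, y, c)] : List (ℕ × ℂ × ℂ)).get j).2.1 ^ ((n j : ℕ) + 1) /
        ((((n j : ℕ) + 1 : ℕ) : ℂ) +
          (([(k, x, b), (l, y, c)] : List (ℕ × ℂ × ℂ)).get j).2.2 - 1) ^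
          (([(k, x, b), (l, y, c)] : List (ℕ × ℂ × ℂ)).get j).1)
  by_cases hn : (n 0 : ℕ) < (n 1 : ℕ)
  · rw [if_pos (h.2 hn)]
    refine Eq.trans h2 ?_
    exact (if_pos hn).symm
  · rw [if_neg (fun h' => hn (h.1 h'))]
    exact (if_neg hn).symm

lemma aux_cmhz_one (k : ℕ) (x b : ℂ)
    (h : Summable fun n : ℕ => x ^ (n + 1) / (((n + 1 : ℕ) : ℂ) + b - 1) ^ k) :
    cmhz [(k, x, b)] = ∑' n : ℕ, x ^ (n + 1) / (((n + 1 : ℕ) : ℂ) + b - 1) ^ k := by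
  unfold cmhz
  refine Tendsto.limUnder_eq ?_
  rw [funext (aux_cmhzP_one k x b)]
  exact h.hasSum.tendsto_sum_nat

lemma aux_cmhz_two (k l : ℕ) (x b y c : ℂ)
    (h : Summable fun p : ℕ × ℕ => if p.1 < p.2 then
          x ^ (p.1 + 1) / (((p.1 + 1 : ℕ) : ℂ) + b - 1) ^ k *
          (y ^ (p.2 + 1) / (((p.2 + 1 : ℕ) : ℂ) + c - 1) ^ l) else 0) :
    cmhz [(k, x, b), (l, y, c)] = ∑' p : ℕ × ℕ, if p.1 < p.2 then
          x ^ (p.1 + 1) / (((p.1 + 1 : ℕ) : ℂ) + b - 1) ^ k *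
          (y ^ (p.2 + 1) / (((p.2 + 1 : ℕ) : ℂ) + c - 1) ^ l) else 0 := by
  unfold cmhz
  refine Tendsto.limUnder_eq ?_
  rw [funext (aux_cmhzP_two k l x b y c)]
  have h0 : Tendsto (fun N : ℕ => (range N, range N)) atTop atTop := by
    rw [← prod_atTop_atTop_eq]
    exact tendsto_finset_range.prodMk tendsto_finset_range
  have h1 : Tendsto (fun N : ℕ => range N ×ˢ range N) atTop atTop :=
    (tendsto_finsetProd_atTop (ι := ℕ) (ι' := ℕ)).comp h0
  exact h.hasSum.comp h1

lemma aux_summable_one {x : ℂ} (hx : ‖x‖ = 1) (b : ℂ) {k : ℕ} (hk : 2 ≤ k) :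
    Summable fun n : ℕ => x ^ (n + 1) / (((n + 1 : ℕ) : ℂ) + b - 1) ^ k := by
  have h := (EisensteinSeries.linear_right_summable b 1 (k := k) (by exact_mod_cast hk)).norm
  have h2 := h.comp_injective (Nat.cast_injective (R := ℤ))
  refine Summable.of_norm_bounded h2 fun n => le_of_eq ?_
  have e : (((n + 1 : ℕ) : ℂ) + b - 1) = b + n := by push_cast; ring
  rw [e]
  simp [hx]

/-- The summand of the full double series. -/
noncomputable def auxG (x a b : ℂ) (q : ℤ × ℤ) : ℂ :=
  x ^ (q.1 + q.2) * (-1) ^ q.2 / (((q.1 : ℂ) + b) ^ 2 * ((q.2 : ℂ) - a) ^ 2)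

lemma aux_summable_G {x : ℂ} (hx : ‖x‖ = 1) (a b : ℂ) : Summable (auxG x a b) := by
  refine Summable.of_norm_bounded
    ((aux_summable_sq b).mul_of_nonneg (aux_summable_sq (-a))
      (fun _ => by positivity) (fun _ => by positivity)) fun q => le_of_eq ?_
  simp [auxG, hx, norm_zpow, sub_eq_add_neg, mul_comm]

lemma aux_summable_ite {ι : Type*} {g : ι → ℂ} (hg : Summable g) (P : ι → Prop)
    [DecidablePred P] : Summable fun q => if P q then g q else 0 := by
  refine Summable.of_norm_bounded hg.norm fun q => ?_
  split_ifs <;> simp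

lemma aux_S1 {x : ℂ} (hx : ‖x‖ = 1) (a b : ℂ) :
    cmhz [(2, x⁻¹, 1 - b), (2, -x, 1 - a)]
      = ∑' q : ℤ × ℤ, if q.1 < 0 ∧ 0 < q.1 + q.2 then auxG x a b q else 0 := by
  have hx0 : x ≠ 0 := by rintro rfl; simp at hx
  have hinj : Function.Injective (fun p : ℕ × ℕ => ((-((p.1 : ℤ) + 1), (p.2 : ℤ) + 1) : ℤ × ℤ)) := by
    rintro ⟨i, j⟩ ⟨k, l⟩ h
    simp only [Prod.mk.injEq] at h ⊢
    omega
  have hS := aux_summable_ite (aux_summable_G hx a b) (fun q => q.1 < 0 ∧ 0 < q.1 + q.2)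
  have key : ∀ p : ℕ × ℕ, (if p.1 < p.2 then
          x⁻¹ ^ (p.1 + 1) / (((p.1 + 1 : ℕ) : ℂ) + (1 - b) - 1) ^ 2 *
          ((-x) ^ (p.2 + 1) / (((p.2 + 1 : ℕ) : ℂ) + (1 - a) - 1) ^ 2) else 0)
      = (fun q : ℤ × ℤ => if q.1 < 0 ∧ 0 < q.1 + q.2 then auxG x a b q else 0)
        ((-((p.1 : ℤ) + 1), (p.2 : ℤ) + 1)) := by
    rintro ⟨n, m⟩
    simp only
    refine if_congr (by omega) ?_ rfl
    simp only [auxG]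
    have e1 : x ^ (-((n : ℤ) + 1) + ((m : ℤ) + 1)) = x⁻¹ ^ (n + 1) * x ^ (m + 1) := by
      rw [zpow_add₀ hx0, zpow_neg, inv_pow]
      norm_cast
    have e2 : (-1 : ℂ) ^ ((m : ℤ) + 1) = (-1) ^ (m + 1) := by norm_cast
    have e3 : ((n + 1 : ℕ) : ℂ) + (1 - b) - 1 = -(((-((n : ℤ) + 1) : ℤ) : ℂ) + b) := by
      push_cast; ring
    have e4 : ((m + 1 : ℕ) : ℂ) + (1 - a) - 1 = (((m : ℤ) + 1 : ℤ) : ℂ) - a := by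
      push_cast; ring
    rw [e1, e2, e3, e4, neg_sq, neg_pow x, div_mul_div_comm]
    ring
  rw [aux_cmhz_two, tsum_congr key]
  · refine hinj.tsum_eq (f := fun q : ℤ × ℤ =>
      if q.1 < 0 ∧ 0 < q.1 + q.2 then auxG x a b q else 0) ?_
    rintro ⟨p, m⟩ h
    have h' : p < 0 ∧ 0 < p + m := by
      by_contra hc
      exact h (if_neg hc)
    refine ⟨((-p - 1).toNat, (m - 1).toNat), ?_⟩
    simp only [Prod.mk.injEq]
    omega
  · rw [funext key]
    exact hS.comp_injective hinj

lemma aux_S2 {x : ℂ} (hx : ‖x‖ = 1) (a b : ℂ) :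
    -cmhz [(2, -x⁻¹, a), (2, x, b)]
      = ∑' q : ℤ × ℤ, if q.2 ≤ 0 ∧ 0 < q.1 + q.2 then auxG x a b q else 0 := by
  have hx0 : x ≠ 0 := by rintro rfl; simp at hx
  have hinj : Function.Injective (fun p : ℕ × ℕ => (((p.2 : ℤ), -(p.1 : ℤ)) : ℤ × ℤ)) := by
    rintro ⟨i, j⟩ ⟨k, l⟩ h
    simp only [Prod.mk.injEq] at h ⊢
    omega
  have hS := aux_summable_ite (aux_summable_G hx a b) (fun q => q.2 ≤ 0 ∧ 0 < q.1 + q.2)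
  have key : ∀ p : ℕ × ℕ, (if p.1 < p.2 then
          (-x⁻¹) ^ (p.1 + 1) / (((p.1 + 1 : ℕ) : ℂ) + a - 1) ^ 2 *
          (x ^ (p.2 + 1) / (((p.2 + 1 : ℕ) : ℂ) + b - 1) ^ 2) else 0)
      = -(fun q : ℤ × ℤ => if q.2 ≤ 0 ∧ 0 < q.1 + q.2 then auxG x a b q else 0)
        (((p.2 : ℤ), -(p.1 : ℤ))) := by
    rintro ⟨n, m⟩
    simp only
    rw [neg_ite, neg_zero]
    refine if_congr (by omega) ?_ rfl
    simp only [auxG]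
    have e1 : x ^ ((m : ℤ) + -(n : ℤ)) = x⁻¹ ^ (n + 1) * x ^ (m + 1) := by
      rw [zpow_add₀ hx0, zpow_neg, inv_pow, zpow_natCast, zpow_natCast]
      field_simp
      ring
    have e2 : (-1 : ℂ) ^ (-(n : ℤ)) = (-1) ^ n := by
      rw [zpow_neg, zpow_natCast, ← inv_pow]
      norm_num
    have e3 : ((n + 1 : ℕ) : ℂ) + a - 1 = -(((-(n : ℤ) : ℤ) : ℂ) - a) := by
      push_cast; ring
    have e4 : ((m + 1 : ℕ) : ℂ) + b - 1 = ((m : ℤ) : ℂ) + b := by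
      push_cast; ring
    rw [e1, e2, e3, e4, neg_sq, neg_pow x⁻¹, div_mul_div_comm]
    ring
  rw [aux_cmhz_two, tsum_congr key, tsum_neg, neg_neg]
  · refine hinj.tsum_eq (f := fun q : ℤ × ℤ =>
      if q.2 ≤ 0 ∧ 0 < q.1 + q.2 then auxG x a b q else 0) ?_
    rintro ⟨p, m⟩ h
    have h' : m ≤ 0 ∧ 0 < p + m := by
      by_contra hc
      exact h (if_neg hc)
    refine ⟨((-m).toNat, p.toNat), ?_⟩
    simp only [Prod.mk.injEq]
    omega
  · rw [funext key]
    exact (hS.comp_injective hinj).neg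

lemma aux_S3 {x : ℂ} (hx : ‖x‖ = 1) (a b : ℂ) :
    x⁻¹ * lih1 2 x b * lih1 2 (-x) (1 - a)
      = ∑' q : ℤ × ℤ, if 0 ≤ q.1 ∧ 0 < q.2 then auxG x a b q else 0 := by
  have hx0 : x ≠ 0 := by rintro rfl; simp at hx
  have hxn : ‖-x‖ = 1 := by simpa using hx
  have hinj : Function.Injective (fun p : ℕ × ℕ => (((p.1 : ℤ), (p.2 : ℤ) + 1) : ℤ × ℤ)) := by
    rintro ⟨i, j⟩ ⟨k, l⟩ h
    simp only [Prod.mk.injEq] at h ⊢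
    omega
  have s1 := aux_summable_one hx b (le_refl 2)
  have s2 := aux_summable_one hxn (1 - a) (le_refl 2)
  rw [lih1, lih1, aux_cmhz_one _ _ _ s1, aux_cmhz_one _ _ _ s2, mul_assoc,
    tsum_mul_tsum_of_summable_norm s1.norm s2.norm, ← tsum_mul_left]
  have key : ∀ p : ℕ × ℕ, x⁻¹ * (x ^ (p.1 + 1) / (((p.1 + 1 : ℕ) : ℂ) + b - 1) ^ 2 *
          ((-x) ^ (p.2 + 1) / (((p.2 + 1 : ℕ) : ℂ) + (1 - a) - 1) ^ 2))
      = (fun q : ℤ × ℤ => if 0 ≤ q.1 ∧ 0 < q.2 then auxG x a b q else 0)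
        (((p.1 : ℤ), (p.2 : ℤ) + 1)) := by
    rintro ⟨n, m⟩
    simp only
    rw [if_pos (by omega)]
    simp only [auxG]
    have e1 : x ^ ((n : ℤ) + ((m : ℤ) + 1)) = x⁻¹ * (x ^ (n + 1) * x ^ (m + 1)) := by
      rw [pow_succ x n, mul_comm (x ^ n) x, mul_assoc, inv_mul_cancel_left₀ hx0, ← pow_add]
      norm_cast
    have e2 : (-1 : ℂ) ^ ((m : ℤ) + 1) = (-1) ^ (m + 1) := by norm_cast
    have e3 : ((n + 1 : ℕ) : ℂ) + b - 1 = ((n : ℤ) : ℂ) + b := by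
      push_cast; ring
    have e4 : ((m + 1 : ℕ) : ℂ) + (1 - a) - 1 = (((m : ℤ) + 1 : ℤ) : ℂ) - a := by
      push_cast; ring
    rw [e1, e2, e3, e4, neg_pow x, div_mul_div_comm]
    ring
  rw [tsum_congr key]
  refine hinj.tsum_eq (f := fun q : ℤ × ℤ =>
      if 0 ≤ q.1 ∧ 0 < q.2 then auxG x a b q else 0) ?_
  rintro ⟨p, m⟩ h
  have h' : 0 ≤ p ∧ 0 < m := by
    by_contra hc
    exact h (if_neg hc)
  refine ⟨(p.toNat, (m - 1).toNat), ?_⟩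
  simp only [Prod.mk.injEq]
  omega

lemma aux_S4 {x : ℂ} (hx : ‖x‖ = 1) (a b : ℂ) :
    (∑' q : ℤ × ℤ, if 0 < q.1 + q.2 then auxG x a b q else 0)
      = ∑' t : ℕ, ∑' m : ℤ, x ^ (t + 1) *
        ((-1 : ℂ) ^ m / ((((t + 1 : ℕ) : ℂ) - m + b) ^ 2 * ((m : ℂ) - a) ^ 2)) := by
  have hinj : Function.Injective
      (fun p : ℕ × ℤ => (((p.1 : ℤ) + 1 - p.2, p.2) : ℤ × ℤ)) := by
    rintro ⟨i, j⟩ ⟨k, l⟩ h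
    simp only [Prod.mk.injEq] at h ⊢
    omega
  have hS := aux_summable_ite (aux_summable_G hx a b) (fun q => 0 < q.1 + q.2)
  have key : ∀ p : ℕ × ℤ, (fun q : ℤ × ℤ => if 0 < q.1 + q.2 then auxG x a b q else 0)
        (((p.1 : ℤ) + 1 - p.2, p.2)) = x ^ (p.1 + 1) *
        ((-1 : ℂ) ^ p.2 / ((((p.1 + 1 : ℕ) : ℂ) - p.2 + b) ^ 2 * ((p.2 : ℂ) - a) ^ 2)) := by
    rintro ⟨t, m⟩
    simp only
    rw [if_pos (by omega)]
    simp only [auxG]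
    have e1 : x ^ ((t : ℤ) + 1 - m + m) = x ^ (t + 1) := by
      rw [sub_add_cancel]
      norm_cast
    rw [e1]
    push_cast
    ring
  have hsum := hS.comp_injective hinj
  rw [← hinj.tsum_eq (f := fun q : ℤ × ℤ => if 0 < q.1 + q.2 then auxG x a b q else 0),
    tsum_congr key]
  · refine Summable.tsum_prod (f := fun p : ℕ × ℤ => x ^ (p.1 + 1) *
        ((-1 : ℂ) ^ p.2 / ((((p.1 + 1 : ℕ) : ℂ) - p.2 + b) ^ 2 * ((p.2 : ℂ) - a) ^ 2))) ?_
    rw [← funext key]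
    exact hsum
  · rintro ⟨p, m⟩ h
    have h' : 0 < p + m := by
      by_contra hc
      exact h (if_neg hc)
    refine ⟨((p + m - 1).toNat, m), ?_⟩
    simp only [Prod.mk.injEq]
    refine ⟨?_, trivial⟩
    omega

/-- Second example after Corollary `corone-sect-4`. -/
theorem example_Li22_alternating (x : ℂ) (hx : IsRootOfUnity x)
    (a b : ℂ) (ha : ∀ z : ℤ, a ≠ (z : ℂ)) (hb : ∀ z : ℤ, b ≠ (z : ℂ))
    (hba : ∀ t : ℕ, b - a ≠ -((t : ℂ) + 1)) :
    cmhz [(2, x⁻¹, 1 - b), (2, -x, 1 - a)] - cmhz [(2, -x⁻¹, a), (2, x, b)]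
      + x⁻¹ * lih1 2 x b * lih1 2 (-x) (1 - a)
      = (Real.pi : ℂ) ^ 2 * (Complex.sin ((Real.pi : ℂ) * a))⁻¹
          * (Complex.cos ((Real.pi : ℂ) * a) / Complex.sin ((Real.pi : ℂ) * a))
          * lih1 2 x (1 + b - a)
        + (Real.pi : ℂ) ^ 2 * (Complex.sin ((Real.pi : ℂ) * b))⁻¹
          * (Complex.cos ((Real.pi : ℂ) * b) / Complex.sin ((Real.pi : ℂ) * b))
          * lih1 2 (-x) (1 + b - a)
        + 2 * (Real.pi : ℂ) * (Complex.sin ((Real.pi : ℂ) * b))⁻¹ * lih1 3 (-x) (1 + b - a)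
        - 2 * (Real.pi : ℂ) * (Complex.sin ((Real.pi : ℂ) * a))⁻¹ * lih1 3 x (1 + b - a) := by

  have hx1 : ‖x‖ = 1 := by
    obtain ⟨N, hN, h⟩ := hx
    exact Complex.norm_eq_one_of_pow_eq_one h hN.ne'
  have hxn : ‖-x‖ = 1 := by simpa using hx1
  have hG := aux_summable_G hx1 a b
  have hsplit : (∑' q : ℤ × ℤ, if 0 < q.1 + q.2 then auxG x a b q else 0)
      = (∑' q : ℤ × ℤ, if q.1 < 0 ∧ 0 < q.1 + q.2 then auxG x a b q else 0)
      + (∑' q : ℤ × ℤ, if q.2 ≤ 0 ∧ 0 < q.1 + q.2 then auxG x a b q else 0)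
      + (∑' q : ℤ × ℤ, if 0 ≤ q.1 ∧ 0 < q.2 then auxG x a b q else 0) := by
    have s1 := aux_summable_ite hG (fun q => q.1 < 0 ∧ 0 < q.1 + q.2)
    have s2 := aux_summable_ite hG (fun q => q.2 ≤ 0 ∧ 0 < q.1 + q.2)
    have s3 := aux_summable_ite hG (fun q => 0 ≤ q.1 ∧ 0 < q.2)
    rw [← s1.tsum_add s2, ← (s1.add s2).tsum_add s3]
    refine tsum_congr fun q => ?_
    split_ifs <;> first | omega | simp
  rw [sub_eq_add_neg, aux_S1 hx1, aux_S2 hx1, aux_S3 hx1, ← hsplit, aux_S4 hx1]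
  have hne : ∀ t : ℕ, ((t + 1 : ℕ) : ℂ) + b - a ≠ 0 := by
    intro t h
    apply hba t
    push_cast at h
    linear_combination h
  have hin := fun t : ℕ => ((aux_inner ha hb (t + 1) (hne t)).mul_left (x ^ (t + 1))).tsum_eq
  rw [tsum_congr hin]
  have u1 := aux_summable_one hx1 (1 + b - a) (le_refl 2)
  have u2 := aux_summable_one hxn (1 + b - a) (le_refl 2)
  have u3 := aux_summable_one hx1 (1 + b - a) (show 2 ≤ 3 by norm_num)
  have u4 := aux_summable_one hxn (1 + b - a) (show 2 ≤ 3 by norm_num)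
  rw [lih1, lih1, lih1, lih1, aux_cmhz_one _ _ _ u1, aux_cmhz_one _ _ _ u2,
    aux_cmhz_one _ _ _ u3, aux_cmhz_one _ _ _ u4]
  refine HasSum.tsum_eq ?_
  refine aux_hasSum_congr ((((u1.hasSum.mul_left _).add (u2.hasSum.mul_left _)).add
    (u4.hasSum.mul_left _)).sub (u3.hasSum.mul_left _)) ?_ rfl
  intro t
  have e : ((t + 1 : ℕ) : ℂ) + (1 + b - a) - 1 = ((t + 1 : ℕ) : ℂ) + b - a := by ring
  simp only [e]
  rw [neg_pow x]
  ring
end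

section
/- Let n ≥ 1 and r ≥ 1 be integers, k_1, …, k_r positive integers, x_1, …, x_r roots of unity with (k_r, x_r) ≠ (1,1), and a_1, …, a_r ∈ ℂ∖ℤ. Then lim_{N→∞} Σ_{(n_1,…,n_r) ∈ ℤ^r, −(n−1) < n_1 < ⋯ < n_r ≤ N} Π_{j=1}^r x_j^{n_j} (n_j + a_j − 1)^{−k_j} = Σ_{j=0}^{r} (−1)^{k_1+⋯+k_j} (x_1⋯x_j) ζ_{n−1}(k_j, k_{j−1}, …, k_1; x_j^{−1}, x_{j−1}^{−1}, …, x_1^{−1}; −a_j, −a_{j−1}, …, −a_1) Li_{k_{j+1},…,k_r}(x_{j+1},…,x_r; a_{j+1},…,a_r); in particular the limit of partial sums on the left exists. -/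
open Filter Finset

open scoped Classical in
/-- Generic nested sum over strictly increasing tuples. -/
noncomputable def GS (f : ℕ → ℕ → ℂ) (r M : ℕ) : ℂ :=
  ∑ w ∈ Finset.univ.filter (fun w : Fin r → Fin M => StrictMono w), ∏ j : Fin r, f j (w j)

lemma GS_zero (f : ℕ → ℕ → ℂ) (M : ℕ) : GS f 0 M = 1 := by
  unfold GS
  rw [Finset.filter_true_of_mem]
  · simp
  · intro w _ i
    exact i.elim0

lemma sigma_fin_ext {r M : ℕ} (q p : Fin M) (h : q = p) (g : Fin r → Fin q) (w : Fin r → Fin p)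
    (hg : ∀ i, (g i : ℕ) = w i) :
    (⟨q, g⟩ : (p : Fin M) × (Fin r → Fin p)) = ⟨p, w⟩ := by
  subst h
  congr 1
  funext i
  exact Fin.ext (hg i)

lemma GS_succ (f : ℕ → ℕ → ℂ) (r M : ℕ) :
    GS f (r + 1) M = ∑ p ∈ Finset.range M, f r p * GS f r p := by
  classical
  unfold GS
  rw [← Fin.sum_univ_eq_sum_range (fun p => f r p * ∑ w ∈ Finset.univ.filter
    (fun w : Fin r → Fin p => StrictMono w), ∏ j : Fin r, f j (w j)) M]
  simp_rw [Finset.mul_sum]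
  rw [Finset.sum_sigma']
  symm
  refine Finset.sum_bij'
    (i := fun (s : (p : Fin M) × (Fin r → Fin p)) _ =>
      (Fin.snoc (fun i => Fin.castLE s.1.2.le (s.2 i)) s.1 : Fin (r + 1) → Fin M))
    (j := fun (w : Fin (r + 1) → Fin M) hw => (⟨w (Fin.last r), fun i =>
      ⟨w i.castSucc, (Finset.mem_filter.1 hw).2 (Fin.castSucc_lt_last i)⟩⟩ :
        (p : Fin M) × (Fin r → Fin p))) ?_ ?_ ?_ ?_ ?_
  · rintro ⟨p, w⟩ h
    simp only [Finset.mem_sigma, Finset.mem_univ, true_and, Finset.mem_filter] at h ⊢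
    intro a b hab
    induction b using Fin.lastCases with
    | last =>
      induction a using Fin.lastCases with
      | last => exact absurd hab (lt_irrefl _)
      | cast a =>
        simp only [Fin.snoc_castSucc, Fin.snoc_last]
        exact (w a).2
    | cast b =>
      induction a using Fin.lastCases with
      | last => exact absurd hab (not_lt.2 (Fin.le_last _))
      | cast a =>
        simp only [Fin.snoc_castSucc]
        exact h (by simpa using hab)
  · intro w hw
    simp only [Finset.mem_sigma, Finset.mem_univ, true_and, Finset.mem_filter] at hw ⊢
    intro a b hab
    exact hw (by simpa using hab)
  · rintro ⟨p, w⟩ h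
    exact sigma_fin_ext _ _ (by simp) _ _ (by simp)
  · intro w hw
    funext i
    induction i using Fin.lastCases with
    | last => simp
    | cast i => simp
  · rintro ⟨p, w⟩ h
    rw [Fin.prod_univ_castSucc]
    simp [mul_comm]

lemma GS_split (f : ℕ → ℕ → ℂ) (c r N : ℕ) :
    GS f r (c + N) = ∑ j ∈ Finset.range (r + 1),
      GS f j c * GS (fun i p => f (j + i) (c + p)) (r - j) N := by
  induction r generalizing N with
  | zero => simp [GS_zero]
  | succ r ih =>
    rw [GS_succ, Finset.sum_range_add, ← GS_succ, Finset.sum_range_succ _ (r + 1)]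
    simp only [Nat.sub_self, GS_zero, mul_one]
    rw [add_comm]
    congr 1
    simp_rw [ih, Finset.mul_sum]
    rw [Finset.sum_comm]
    refine Finset.sum_congr rfl fun j hj => ?_
    have hj' : j ≤ r := by simpa [Nat.lt_succ_iff] using hj
    rw [Nat.succ_sub hj', GS_succ, Finset.mul_sum]
    refine Finset.sum_congr rfl fun p _ => ?_
    rw [Nat.add_sub_cancel' hj']
    ring

lemma GS_rev (f g : ℕ → ℕ → ℂ) (r c : ℕ)
    (h : ∀ i < r, ∀ p < c, f i p = g (r - 1 - i) (c - 1 - p)) : GS f r c = GS g r c := by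
  classical
  unfold GS
  refine Finset.sum_equiv (Equiv.arrowCongr Fin.revPerm Fin.revPerm) ?_ ?_
  · intro w
    simp only [Finset.mem_filter, Finset.mem_univ, true_and]
    constructor
    · intro hw a b hab
      simpa using hw (Fin.rev_lt_rev.2 hab)
    · intro hw a b hab
      have := hw (Fin.rev_lt_rev.2 hab)
      simpa using this
  · intro w _
    refine Fintype.prod_equiv Fin.revPerm _ _ fun j => ?_
    rw [h j j.2 (w j) (w j).2]
    simp only [Equiv.arrowCongr_apply, Function.comp, Fin.revPerm_apply, Fin.revPerm_symm,
      Fin.rev_rev, Fin.val_rev]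
    congr 1 <;> omega

lemma GS_congr (f g : ℕ → ℕ → ℂ) (r c : ℕ)
    (h : ∀ i < r, ∀ p < c, f i p = g i p) : GS f r c = GS g r c := by
  unfold GS
  exact Finset.sum_congr rfl fun w _ => Finset.prod_congr rfl fun j _ => h j j.2 _ (w j).2

lemma GS_smul (f : ℕ → ℕ → ℂ) (e : ℕ → ℂ) (r c : ℕ) :
    GS (fun i p => e i * f i p) r c = (∏ i ∈ Finset.range r, e i) * GS f r c := by
  unfold GS
  rw [Finset.mul_sum]
  refine Finset.sum_congr rfl fun w _ => ?_
  rw [Finset.prod_mul_distrib, Fin.prod_univ_eq_prod_range]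

lemma cmhzP_cast (K : List (ℕ × ℂ × ℂ)) (m N : ℕ) (h : K.length = m) (f : ℕ → ℕ → ℂ)
    (hf : ∀ j : Fin m, ∀ p : ℕ, f j p = (K.get (Fin.cast h.symm j)).2.1 ^ (p + 1) /
        (((p + 1 : ℕ) : ℂ) + (K.get (Fin.cast h.symm j)).2.2 - 1) ^
          (K.get (Fin.cast h.symm j)).1) :
    cmhzP K N = GS f m N := by
  subst h
  unfold cmhzP GS
  refine Finset.sum_congr rfl fun w _ => Finset.prod_congr rfl fun j _ => ?_
  rw [hf j]
  rfl

lemma cmhzP_ofFn (m N : ℕ) (k : ℕ → ℕ) (x a : ℕ → ℂ) :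
    cmhzP (List.ofFn fun t : Fin m => (k t, x t, a t)) N =
      GS (fun i p => x i ^ (p + 1) / (((p + 1 : ℕ) : ℂ) + a i - 1) ^ k i) m N := by
  refine cmhzP_cast _ m N (List.length_ofFn) _ fun j p => ?_
  simp

lemma inv_bound (b : ℂ) : ∃ C : ℝ, 0 < C ∧ ∀ p : ℕ, ‖((p : ℂ) + b)⁻¹‖ ≤ C / (p + 1) := by
  have h0 : Tendsto (fun p : ℕ => (p : ℂ)) atTop (Bornology.cobounded ℂ) := by
    rw [← tendsto_norm_atTop_iff_cobounded]
    simpa using tendsto_natCast_atTop_atTop (R := ℝ)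
  have h1 : Tendsto (fun p : ℕ => ((p : ℂ) + b)⁻¹) atTop (nhds 0) := by
    refine tendsto_inv₀_cobounded.comp ?_
    exact (tendsto_add_const_cobounded b).comp h0
  have h2 : Tendsto (fun p : ℕ => ‖((p : ℂ) + b)⁻¹‖) atTop (nhds ‖(0 : ℂ)‖) := h1.norm
  obtain ⟨D, hD⟩ := h2.bddAbove_range
  have hD' : ∀ p : ℕ, ‖((p : ℂ) + b)⁻¹‖ ≤ D := fun p => hD ⟨p, rfl⟩
  have hD0 : 0 ≤ D := (norm_nonneg _).trans (hD' 0)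
  refine ⟨1 + D * ‖1 - b‖, by positivity, fun p => ?_⟩
  rw [le_div_iff₀ (by positivity)]
  by_cases hz : (p : ℂ) + b = 0
  · rw [hz]; simp; positivity
  have h3 : ((p : ℂ) + b)⁻¹ * (p + 1) = 1 + ((p : ℂ) + b)⁻¹ * (1 - b) := by
    field_simp; ring
  have h4 : ‖((p : ℂ) + 1)‖ = (p : ℝ) + 1 := by
    have := Complex.norm_natCast (p + 1)
    push_cast at this
    exact this
  rw [← h4, ← norm_mul, h3]
  refine (norm_add_le _ _).trans ?_
  rw [norm_one, norm_mul]
  gcongr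
  exact hD' p

lemma sum_inv_sqrt (M : ℕ) :
    ∑ p ∈ Finset.range M, 1 / √((p : ℝ) + 1) ≤ 2 * √(M : ℝ) := by
  induction M with
  | zero => simp
  | succ M ih =>
    rw [Finset.sum_range_succ]
    push_cast
    have h1 : √(M : ℝ) ^ 2 = M := Real.sq_sqrt (by positivity)
    have h2 : √((M : ℝ) + 1) ^ 2 = M + 1 := Real.sq_sqrt (by positivity)
    have h3 : 0 < √((M : ℝ) + 1) := by positivity
    have h5 : 1 / √((M : ℝ) + 1) ≤ 2 * √((M : ℝ) + 1) - 2 * √(M : ℝ) := by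
      rw [div_le_iff₀ h3]
      nlinarith [sq_nonneg (√((M : ℝ) + 1) - √(M : ℝ))]
    linarith

lemma GS_bound (f : ℕ → ℕ → ℂ) (r : ℕ)
    (hf : ∀ i < r, ∃ C : ℝ, 0 ≤ C ∧ ∀ p : ℕ, ‖f i p‖ ≤ C / (p + 1)) :
    ∃ D : ℝ, 0 ≤ D ∧ ∀ M : ℕ, ‖GS f r M‖ ≤ D * √((M : ℝ) + 1) := by
  induction r with
  | zero =>
    refine ⟨1, zero_le_one, fun M => ?_⟩
    rw [GS_zero, norm_one, one_mul]
    exact Real.one_le_sqrt.2 (by linarith [Nat.cast_nonneg (α := ℝ) M])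
  | succ r ih =>
    obtain ⟨D, hD0, hD⟩ := ih fun i hi => hf i (by omega)
    obtain ⟨C, hC0, hC⟩ := hf r (by omega)
    refine ⟨C * D * 2, by positivity, fun M => ?_⟩
    rw [GS_succ]
    calc ‖∑ p ∈ Finset.range M, f r p * GS f r p‖
        ≤ ∑ p ∈ Finset.range M, C * D * (1 / √((p : ℝ) + 1)) := by
          refine norm_sum_le_of_le _ fun p _ => ?_
          rw [norm_mul]
          calc ‖f r p‖ * ‖GS f r p‖ ≤ C / (p + 1) * (D * √((p : ℝ) + 1)) := by
                gcongr
                · exact hC p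
                · exact hD p
            _ = C * D * (1 / √((p : ℝ) + 1)) := by
                have h2 : √((p : ℝ) + 1) ^ 2 = p + 1 := Real.sq_sqrt (by positivity)
                have h3 : 0 < √((p : ℝ) + 1) := by positivity
                rw [← h2]
                have h4 : √(√((p : ℝ) + 1) ^ 2) = √((p : ℝ) + 1) := by rw [h2]
                rw [h4]
                field_simp
      _ ≤ C * D * (2 * √(M : ℝ)) := by
          rw [← Finset.mul_sum]
          gcongr
          exact sum_inv_sqrt M
      _ ≤ C * D * (2 * √((M : ℝ) + 1)) := by
          gcongr
          linarith
      _ = _ := by ring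

lemma summable_aux : Summable fun p : ℕ => √((p : ℝ) + 1) / ((p : ℝ) + 1) ^ 2 := by
  have h : Summable fun n : ℕ => 1 / (n : ℝ) ^ (3 / 2 : ℝ) :=
    Real.summable_one_div_nat_rpow.2 (by norm_num)
  have h' := (summable_nat_add_iff 1).2 h
  refine h'.congr fun p => ?_
  have hp : 0 < (p : ℝ) + 1 := by positivity
  push_cast
  rw [Real.sqrt_eq_rpow, ← Real.rpow_natCast, ← Real.rpow_sub hp, one_div, ← Real.rpow_neg hp.le]
  norm_num

lemma tendsto_of_bound (g : ℕ → ℂ) (D : ℝ)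
    (h : ∀ p : ℕ, ‖g p‖ ≤ D * (√((p : ℝ) + 1) / ((p : ℝ) + 1) ^ 2)) :
    ∃ L, Tendsto (fun M => ∑ p ∈ Finset.range M, g p) atTop (nhds L) := by
  have hs : Summable g := Summable.of_norm_bounded (summable_aux.mul_left D) h
  exact ⟨_, hs.hasSum.tendsto_sum_nat⟩

lemma abel_parts (u g : ℕ → ℂ) (M : ℕ) :
    ∑ p ∈ Finset.range M, u p * g p = u M * (∑ q ∈ Finset.range M, g q) -
      ∑ p ∈ Finset.range M, (u (p + 1) - u p) * ∑ q ∈ Finset.range (p + 1), g q := by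
  induction M with
  | zero => simp
  | succ M ih =>
    rw [Finset.sum_range_succ, ih, Finset.sum_range_succ _ M, Finset.sum_range_succ _ M]
    simp only [Finset.sum_range_succ]
    ring

lemma geom_bound (x : ℂ) (hx : ‖x‖ = 1) (hx1 : x ≠ 1) (M : ℕ) :
    ‖∑ p ∈ Finset.range M, x ^ (p + 1)‖ ≤ 2 / ‖x - 1‖ := by
  simp_rw [pow_succ]
  rw [← Finset.sum_mul, geom_sum_eq hx1, norm_mul, hx, mul_one, norm_div]
  gcongr
  refine (norm_sub_le _ _).trans ?_
  rw [norm_pow, hx]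
  norm_num

lemma GS_tendsto (f : ℕ → ℕ → ℂ) (r : ℕ) (k : ℕ) (x b : ℂ)
    (hf : ∀ i < r, ∃ C : ℝ, 0 ≤ C ∧ ∀ p : ℕ, ‖f i p‖ ≤ C / (p + 1))
    (hx : ‖x‖ = 1) (hk : 0 < k) (hkx : ¬ (k = 1 ∧ x = 1)) (hb : ∀ p : ℕ, (p : ℂ) + b ≠ 0)
    (hfr : ∀ p : ℕ, f r p = x ^ (p + 1) / ((p : ℂ) + b) ^ k) :
    ∃ L, Tendsto (GS f (r + 1)) atTop (nhds L) := by
  obtain ⟨D, hD0, hD⟩ := GS_bound f r hf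
  obtain ⟨C, hC0, hC⟩ := inv_bound b
  have hfun : GS f (r + 1) = fun M => ∑ p ∈ Finset.range M, f r p * GS f r p := by
    funext M
    exact GS_succ f r M
  rw [hfun]
  by_cases hk1 : k = 1
  · have hx1 : x ≠ 1 := fun h => hkx ⟨hk1, h⟩
    subst hk1
    set u : ℕ → ℂ := fun p => GS f r p * ((p : ℂ) + b)⁻¹ with hu
    have hrew : (fun M => ∑ p ∈ Finset.range M, f r p * GS f r p) = fun M =>
        u M * (∑ q ∈ Finset.range M, x ^ (q + 1)) -
        ∑ p ∈ Finset.range M, (u (p + 1) - u p) * ∑ q ∈ Finset.range (p + 1), x ^ (q + 1) := by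
      funext M
      rw [← abel_parts]
      refine Finset.sum_congr rfl fun p _ => ?_
      rw [hfr p, hu, pow_one]
      ring
    rw [hrew]
    -- difference of consecutive nested sums
    have hdiff : ∃ E : ℝ, 0 ≤ E ∧ ∀ p : ℕ,
        ‖GS f r (p + 1) - GS f r p‖ ≤ E * (√((p : ℝ) + 1) / ((p : ℝ) + 1)) := by
      cases r with
      | zero =>
        refine ⟨0, le_rfl, fun p => ?_⟩
        simp [GS_zero]
      | succ r =>
        obtain ⟨D', hD'0, hD'⟩ := GS_bound f r fun i hi => hf i (by omega)
        obtain ⟨C', hC'0, hC'⟩ := hf r (by omega)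
        refine ⟨C' * D', by positivity, fun p => ?_⟩
        rw [GS_succ, GS_succ, Finset.sum_range_succ, add_sub_cancel_left, norm_mul]
        calc ‖f r p‖ * ‖GS f r p‖ ≤ C' / (p + 1) * (D' * √((p : ℝ) + 1)) := by
              gcongr
              · exact hC' p
              · exact hD' p
          _ = _ := by ring
    obtain ⟨E, hE0, hE⟩ := hdiff
    have hC2 : ∀ p : ℕ, ‖((p : ℂ) + 1 + b)⁻¹‖ ≤ C / (p + 1) := by
      intro p
      have h := hC (p + 1)
      push_cast at h
      refine h.trans ?_
      gcongr
      linarith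
    have hud : ∀ p : ℕ, ‖u (p + 1) - u p‖ ≤
        (E * C + D * C * C) * (√((p : ℝ) + 1) / ((p : ℝ) + 1) ^ 2) := by
      intro p
      have hb0 := hb p
      have hb1 := hb (p + 1)
      push_cast at hb1
      have h1 : u (p + 1) - u p = (GS f r (p + 1) - GS f r p) * ((p : ℂ) + 1 + b)⁻¹ -
          GS f r p * (((p : ℂ) + 1 + b)⁻¹ * ((p : ℂ) + b)⁻¹) := by
        simp only [hu]
        push_cast
        field_simp
        ring
      rw [h1]
      refine (norm_sub_le _ _).trans ?_
      rw [norm_mul, norm_mul, norm_mul]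
      calc _ ≤ E * (√((p : ℝ) + 1) / ((p : ℝ) + 1)) * (C / (p + 1)) +
            D * √((p : ℝ) + 1) * (C / (p + 1) * (C / (p + 1))) := by
            gcongr
            · exact hE p
            · exact hC2 p
            · exact hD p
            · exact hC2 p
            · exact hC p
        _ = _ := by
            field_simp
    obtain ⟨L, hL⟩ := tendsto_of_bound
      (fun p => (u (p + 1) - u p) * ∑ q ∈ Finset.range (p + 1), x ^ (q + 1))
      ((E * C + D * C * C) * (2 / ‖x - 1‖)) (by
        intro p
        rw [norm_mul]
        calc _ ≤ ((E * C + D * C * C) * (√((p : ℝ) + 1) / ((p : ℝ) + 1) ^ 2)) *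
              (2 / ‖x - 1‖) := by
              gcongr
              · exact hud p
              · exact geom_bound x hx hx1 _
          _ = _ := by ring)
    refine ⟨0 - L, Tendsto.sub ?_ hL⟩
    have hlim : Tendsto (fun M : ℕ => D * C * (2 / ‖x - 1‖) * (√((M : ℝ) + 1))⁻¹) atTop
        (nhds 0) := by
      have : Tendsto (fun M : ℕ => (√((M : ℝ) + 1))⁻¹) atTop (nhds 0) :=
        tendsto_inv_atTop_zero.comp (Real.tendsto_sqrt_atTop.comp
          (tendsto_atTop_add_const_right _ _ tendsto_natCast_atTop_atTop))
      simpa using this.const_mul (D * C * (2 / ‖x - 1‖))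
    refine squeeze_zero_norm (fun M => ?_) hlim
    rw [norm_mul, hu, norm_mul]
    calc _ ≤ D * √((M : ℝ) + 1) * (C / (M + 1)) * (2 / ‖x - 1‖) := by
          gcongr
          · exact hD M
          · exact hC M
          · exact geom_bound x hx hx1 _
      _ = D * C * (2 / ‖x - 1‖) * (√((M : ℝ) + 1) / (M + 1)) := by ring
      _ = _ := by rw [Real.sqrt_div_self]
  · have hk2 : 2 ≤ k := by omega
    refine tendsto_of_bound _ (C ^ k * D) fun p => ?_
    rw [hfr p, norm_mul, norm_div, norm_pow, hx, one_pow, norm_pow, one_div, ← inv_pow, ← norm_inv]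
    calc _ ≤ (C / (p + 1)) ^ k * (D * √((p : ℝ) + 1)) := by
          gcongr
          · exact hC p
          · exact hD p
      _ = C ^ k * D * (√((p : ℝ) + 1) / ((p : ℝ) + 1) ^ k) := by
          rw [div_pow]; ring
      _ ≤ _ := by
          gcongr
          linarith [Nat.cast_nonneg (α := ℝ) p]

lemma term_bound (k : ℕ) (x b : ℂ) (hx : ‖x‖ = 1) (hk : 0 < k) :
    ∃ C : ℝ, 0 ≤ C ∧ ∀ p : ℕ, ‖x ^ (p + 1) / ((p : ℂ) + b) ^ k‖ ≤ C / (p + 1) := by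
  obtain ⟨C, hC0, hC⟩ := inv_bound b
  refine ⟨C ^ k, by positivity, fun p => ?_⟩
  rw [norm_div, norm_pow, hx, one_pow, norm_pow, one_div, ← inv_pow, ← norm_inv]
  calc _ ≤ (C / (p + 1)) ^ k := by
        gcongr
        exact hC p
    _ = C ^ k / ((p : ℝ) + 1) ^ k := div_pow _ _ _
    _ ≤ _ := by
        gcongr
        exact le_self_pow₀ (by linarith [Nat.cast_nonneg (α := ℝ) p]) (by omega)

/-- Convergence of the cyclotomic multiple Hurwitz zeta value. -/
lemma cmhz_tendsto (m : ℕ) (k : ℕ → ℕ) (x a : ℕ → ℂ)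
    (hk : ∀ i < m, 0 < k i) (hx : ∀ i < m, ‖x i‖ = 1)
    (hm : ∀ i, i + 1 = m → ¬ (k i = 1 ∧ x i = 1))
    (ha : ∀ i < m, ∀ p : ℕ, (p : ℂ) + a i ≠ 0) :
    Tendsto (fun N => GS (fun i p => x i ^ (p + 1) / (((p + 1 : ℕ) : ℂ) + a i - 1) ^ k i) m N) atTop
      (nhds (cmhz (List.ofFn fun t : Fin m => (k t, x t, a t)))) := by
  have hP : cmhzP (List.ofFn fun t : Fin m => (k t, x t, a t)) = fun N =>
      GS (fun i p => x i ^ (p + 1) / (((p + 1 : ℕ) : ℂ) + a i - 1) ^ k i) m N := by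
    funext N
    exact cmhzP_ofFn m N k x a
  unfold cmhz
  rw [hP]
  refine tendsto_nhds_limUnder ?_
  have hs : ∀ i p : ℕ, (((p + 1 : ℕ) : ℂ) + a i - 1) = (p : ℂ) + a i := by
    intro i p; push_cast; ring
  simp_rw [hs]
  cases m with
  | zero => exact ⟨1, by simp only [GS_zero]; exact tendsto_const_nhds⟩
  | succ r =>
    exact GS_tendsto _ r (k r) (x r) (a r)
      (fun i hi => term_bound _ _ _ (hx i (by omega)) (hk i (by omega)))
      (hx r (by omega)) (hk r (by omega)) (hm r rfl) (ha r (by omega)) fun p => rfl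

open scoped Classical in
lemma lhs_eq (F : ℕ → ℤ → ℂ) (n : ℕ) (hn : 1 ≤ n) (r N : ℕ) :
    ∑ v ∈ (Fintype.piFinset fun _ : Fin r =>
            Finset.Icc ((2 : ℤ) - (n : ℤ)) (N : ℤ)).filter (fun v => StrictMono v),
          ∏ j : Fin r, F j (v j) =
      GS (fun i p => F i ((p : ℤ) + 2 - n)) r (n - 1 + N) := by
  unfold GS
  symm
  refine Finset.sum_bij (fun (w : Fin r → Fin (n - 1 + N)) _ => fun j => ((w j : ℕ) : ℤ) + 2 - n)
    ?_ ?_ ?_ ?_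
  · intro w hw
    simp only [Finset.mem_filter, Finset.mem_univ, true_and, Fintype.mem_piFinset,
      Finset.mem_Icc] at hw ⊢
    refine ⟨fun j => ?_, fun i j hij => ?_⟩
    · have := (w j).2
      omega
    · have : (w i : ℕ) < w j := hw hij
      show ((w i : ℕ) : ℤ) + 2 - n < ((w j : ℕ) : ℤ) + 2 - n
      omega
  · intro w _ w' _ h
    funext j
    have := congrFun h j
    ext
    omega
  · intro v hv
    simp only [Finset.mem_filter, Finset.mem_univ, true_and, Fintype.mem_piFinset,
      Finset.mem_Icc] at hv
    obtain ⟨h1, h2⟩ := hv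
    refine ⟨fun j => ⟨(v j + n - 2).toNat, by have := h1 j; omega⟩, ?_, ?_⟩
    · simp only [Finset.mem_filter, Finset.mem_univ, true_and]
      intro i j hij
      have h3 : v i < v j := h2 hij
      have h4 := h1 i
      have h5 := h1 j
      show (v i + n - 2).toNat < (v j + n - 2).toNat
      omega
    · funext j
      have h4 := h1 j
      simp only
      omega
  · intro w _
    rfl

open scoped Classical in
/-- Truncation identity for sums over `−(n−1) < n_1 < ⋯ < n_r ≤ N` of
`Π_j x_j^{n_j} (n_j + a_j − 1)^{−k_j}` (key identity in the proof of
Lemma `lem-Talyor-expansion-CMHZSs`). -/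
theorem truncated_sum_identity (n : ℕ) (hn : 1 ≤ n) (r : ℕ) (hr : 1 ≤ r)
    (k : ℕ → ℕ) (x : ℕ → ℂ) (a : ℕ → ℂ)
    (hk : ∀ i, 1 ≤ i → i ≤ r → 0 < k i)
    (hx : ∀ i, 1 ≤ i → i ≤ r → IsRootOfUnity (x i))
    (hrr : ¬(k r = 1 ∧ x r = 1))
    (ha : ∀ i, 1 ≤ i → i ≤ r → ∀ z : ℤ, a i ≠ (z : ℂ)) :
    ∃ L : ℂ,
      Tendsto (fun N : ℕ =>
        ∑ v ∈ (Fintype.piFinset fun _ : Fin r =>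
            Finset.Icc ((2 : ℤ) - (n : ℤ)) (N : ℤ)).filter (fun v => StrictMono v),
          ∏ j : Fin r,
            x (j.val + 1) ^ (v j) / (((v j : ℤ) : ℂ) + a (j.val + 1) - 1) ^ (k (j.val + 1)))
        atTop (nhds L) ∧
      L = ∑ j : Fin (r + 1),
        (-1 : ℂ) ^ (∑ i ∈ Finset.Icc 1 j.val, k i)
        * (∏ i ∈ Finset.Icc 1 j.val, x i)
        * cmhzP (List.ofFn fun t : Fin j.val =>
            (k (j.val - t.val), (x (j.val - t.val))⁻¹, 1 - a (j.val - t.val))) (n - 1)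
        * cmhz (List.ofFn fun t : Fin (r - j.val) =>
            (k (j.val + 1 + t.val), x (j.val + 1 + t.val), a (j.val + 1 + t.val))) := by
  have hnorm : ∀ i, 1 ≤ i → i ≤ r → ‖x i‖ = 1 := by
    intro i h1 h2
    obtain ⟨N, hN, h⟩ := hx i h1 h2
    exact Complex.norm_eq_one_of_pow_eq_one h hN.ne'
  refine ⟨_, ?_, rfl⟩
  have hL : ∀ N : ℕ, _ = _ := fun N => lhs_eq
    (fun i z => x (i + 1) ^ z / ((z : ℂ) + a (i + 1) - 1) ^ (k (i + 1))) n hn r N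
  simp only [hL, GS_split]
  rw [Fin.sum_univ_eq_sum_range (fun j : ℕ => (-1 : ℂ) ^ (∑ i ∈ Finset.Icc 1 j, k i)
        * (∏ i ∈ Finset.Icc 1 j, x i)
        * cmhzP (List.ofFn fun t : Fin j =>
            (k (j - t.val), (x (j - t.val))⁻¹, 1 - a (j - t.val))) (n - 1)
        * cmhz (List.ofFn fun t : Fin (r - j) =>
            (k (j + 1 + t.val), x (j + 1 + t.val), a (j + 1 + t.val)))) (r + 1)]
  refine tendsto_finsetSum _ fun j hj => ?_
  have hjr : j ≤ r := by simpa [Nat.lt_succ_iff] using hj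
  refine Tendsto.mul ?_ ?_
  · rw [cmhzP_ofFn j (n - 1) (fun t => k (j - t)) (fun t => (x (j - t))⁻¹) (fun t => 1 - a (j - t))]
    refine (tendsto_const_nhds_iff.2 ?_)
    have hprod : (-1 : ℂ) ^ (∑ i ∈ Finset.Icc 1 j, k i) * (∏ i ∈ Finset.Icc 1 j, x i) =
        ∏ i ∈ Finset.range j, ((-1 : ℂ) ^ k (j - i) * x (j - i)) := by
      rw [← Finset.prod_pow_eq_pow_sum, ← Finset.prod_mul_distrib,
        Finset.range_eq_Ico, Finset.prod_Ico_reflect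
          (fun i => (-1 : ℂ) ^ k i * x i) 0 (Nat.le_succ j)]
      refine Finset.prod_congr ?_ fun _ _ => rfl
      ext i
      simp
    rw [hprod, ← GS_smul]
    refine GS_rev _ _ _ _ fun i hi p hp => ?_
    have e1 : j - (j - 1 - i) = i + 1 := by omega
    have hx0 : x (i + 1) ≠ 0 := by
      intro h
      have := hnorm (i + 1) (by omega) (by omega)
      rw [h] at this
      simp at this
    simp only [e1]
    obtain ⟨q, hq⟩ : ∃ q : ℕ, q = n - 1 - 1 - p := ⟨_, rfl⟩
    have e2 : (p : ℤ) + 2 - n = -(q : ℤ) := by omega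
    rw [← hq, e2]
    have e3 : ((-(q : ℤ) : ℤ) : ℂ) + a (i + 1) - 1 =
      (-1) * (((q + 1 : ℕ) : ℂ) + (1 - a (i + 1)) - 1) := by
      push_cast; ring
    rw [e3, mul_pow, zpow_neg, zpow_natCast, inv_pow, pow_succ (x (i + 1))]
    have e4 : ((-1 : ℂ) ^ k (i + 1)) * ((-1 : ℂ) ^ k (i + 1)) = 1 := by
      rw [← mul_pow]; norm_num
    have e5 : ((-1 : ℂ) ^ k (i + 1))⁻¹ = (-1 : ℂ) ^ k (i + 1) := inv_eq_of_mul_eq_one_left e4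
    rw [div_eq_mul_inv, mul_inv, e5]
    field_simp
  · have key := cmhz_tendsto (r - j) (fun t => k (j + 1 + t)) (fun t => x (j + 1 + t))
      (fun t => a (j + 1 + t)) (fun i hi => hk _ (by omega) (by omega))
      (fun i hi => hnorm _ (by omega) (by omega)) (by
        intro i hi
        have : j + 1 + i = r := by omega
        simp only [this]
        exact hrr) (by
        intro i hi p h
        refine ha (j + 1 + i) (by omega) (by omega) (-(p : ℤ)) ?_
        push_cast
        linear_combination h)
    refine key.congr fun N => GS_congr _ _ _ _ fun i hi p hp => ?_
    have e1 : ((n - 1 + p : ℕ) : ℤ) + 2 - n = ((p + 1 : ℕ) : ℤ) := by omega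
    have e2 : j + i + 1 = j + 1 + i := by omega
    simp only [e1, e2, zpow_natCast, Int.cast_natCast]
end
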